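/- Fix n ≥ 1, let Σ := ⋀•(ℂ^{2n−1}) be the exterior algebra on generators y₁, …, y_{2n−1}, with Clifford multiplication operators c₁ := i·Id on even / −i·Id on odd degrees, c_{2j} := i(x_j⌟ + y_j∧), c_{2j+1} := y_j∧ − x_j⌟ (1 ≤ j ≤ 2n−1), and let ω := Σ_{p=1}^{n−1} y_{2p}∧y_{2p+1}. Then for every integer k ≥ 0: (1) Σ_{p=1}^{n−1} ( −c_{4p}∘c_{4p+2} + c_{4p+1}∘c_{4p+3} )(ω^k) = 2( ω^{k+1} − k(n−k)·ω^{k−1} ); and (2) −Σ_{p=1}^{n−1} ( c_{4p}∘c_{4p+3} + c_{4p+1}∘c_{4p+2} )(ω^k) = −2i( ω^{k+1} + k(n−k)·ω^{k−1} ), where ω^{−1} := 0 and ω⁰ := 1. (These are the Clifford products (Φ₂|_H)·ω^k and (Φ₃|_H)·ω^k of the invariant fundamental two-forms restricted to the horizontal distribution, computed in an adapted frame of a (4n−1)-dimensional homogeneous 3-Sasakian space.) -/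

import Mathlib

noncomputable section

/-- The underlying `(2n-1)`-dimensional complex vector space `ℂ^{2n-1}`. -/
abbrev ModelV (n : ℕ) : Type := Fin (2 * n - 1) → ℂ

/-- The exterior-form model `Σ = ⋀•(ℂ^{2n-1})` of the spinor module. -/
abbrev SpinorModel (n : ℕ) : Type := ExteriorAlgebra ℂ (ModelV n)

/-- The generator `y_{j+1}` (so `j` is the 0-based index), with junk value `0` out of range. -/
def yGen (n j : ℕ) : SpinorModel n :=
  if h : j < 2 * n - 1 then
    ExteriorAlgebra.ι ℂ (Pi.single (⟨j, h⟩ : Fin (2 * n - 1)) (1 : ℂ))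
  else 0

/-- Left exterior multiplication `y_{j+1} ∧ ·` (0-based index `j`). -/
def wdg (n j : ℕ) : SpinorModel n →ₗ[ℂ] SpinorModel n :=
  LinearMap.mulLeft ℂ (yGen n j)

/-- Contraction `x_{j+1} ⌟ ·` with the `(j+1)`-st dual basis vector (0-based index `j`),
with junk value `0` out of range. -/
def ctr (n j : ℕ) : SpinorModel n →ₗ[ℂ] SpinorModel n :=
  if h : j < 2 * n - 1 then
    CliffordAlgebra.contractLeft (LinearMap.proj (⟨j, h⟩ : Fin (2 * n - 1)))
  else 0

/-- The Clifford multiplication operators `c_a`, `1 ≤ a ≤ 4n-1`, of the exterior-form model: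
`c₁ = i·Id` on even degrees and `-i·Id` on odd degrees, `c_{2j} = i(x_j⌟ + y_j∧)` and
`c_{2j+1} = y_j∧ - x_j⌟` for `1 ≤ j ≤ 2n-1` (1-based indices). -/
def cop (n a : ℕ) : SpinorModel n →ₗ[ℂ] SpinorModel n :=
  if a = 1 then
    Complex.I • (CliffordAlgebra.involute : SpinorModel n →ₐ[ℂ] SpinorModel n).toLinearMap
  else if a % 2 = 0 then Complex.I • (ctr n (a / 2 - 1) + wdg n (a / 2 - 1))
  else wdg n (a / 2 - 1) - ctr n (a / 2 - 1)

/-- The invariant `2`-form `ω = ∑_{p=1}^{n-1} y_{2p} ∧ y_{2p+1}`. -/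
def om (n : ℕ) : SpinorModel n :=
  ∑ p ∈ Finset.Icc 1 (n - 1), yGen n (2 * p - 1) * yGen n (2 * p)

/-- The invariant Killing spinors `ψ_k = ω^{k+1} - i(k+1)·y₁∧ω^k`, reindexed by
`j = k + 1` (so `psi n j` is `ψ_{j-1}`, and `psi n 0 = ψ_{-1} = 1`). -/
def psi (n j : ℕ) : SpinorModel n :=
  om n ^ j - (Complex.I * (j : ℂ)) • (yGen n 0 * om n ^ (j - 1))

/-- The space of invariant spinors `Σ_inv = span_ℂ{ω^k, y₁∧ω^k : 0 ≤ k ≤ n-1}`. -/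
def Sinv (n : ℕ) : Submodule ℂ (SpinorModel n) :=
  Submodule.span ℂ {x | ∃ k ≤ n - 1, x = om n ^ k ∨ x = yGen n 0 * om n ^ k}

/-- The space of invariant Killing spinors `K = span_ℂ{ψ_k : -1 ≤ k ≤ n-1}`. -/
def KSpan (n : ℕ) : Submodule ℂ (SpinorModel n) :=
  Submodule.span ℂ {x | ∃ j ≤ n, x = psi n j}


/-- Generators anticommute. -/
theorem yGen_mul_yGen (n i j : ℕ) : yGen n i * yGen n j = -(yGen n j * yGen n i) := by
  unfold yGen
  split_ifs <;> simp [eq_neg_iff_add_eq_zero, ExteriorAlgebra.ι_add_mul_swap]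

theorem commute_om_yGen (n j : ℕ) : Commute (om n) (yGen n j) := by
  refine Commute.sum_left _ _ _ fun p _ => ?_
  rw [commute_iff_eq, mul_assoc, yGen_mul_yGen n (2 * p) j, mul_neg, ← mul_assoc,
    yGen_mul_yGen n (2 * p - 1) j, neg_mul, neg_neg, mul_assoc]

theorem ctr_one (n j : ℕ) : ctr n j 1 = 0 := by
  unfold ctr
  split_ifs <;> simp

/-- Contraction is an odd derivation, evaluated on a product with a generator. -/
theorem ctr_yGen_mul (n i j : ℕ) (hj : j < 2 * n - 1) (x : SpinorModel n) :
    ctr n j (yGen n i * x) = (if i = j then x else 0) - yGen n i * ctr n j x := by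
  by_cases hi : i < 2 * n - 1
  · simp only [ctr, yGen, dif_pos hi, dif_pos hj]
    refine (CliffordAlgebra.contractLeft_ι_mul _ _ _).trans ?_
    simp [Pi.single_apply, ite_smul, eq_comm, ExteriorAlgebra.ι]
  · have hij : i ≠ j := by omega
    simp [yGen, hi, hij]

theorem ctr_om_mul (n j : ℕ) (hj : j < 2 * n - 1) (x : SpinorModel n) :
    ctr n j (om n * x) =
      (∑ p ∈ Finset.Icc 1 (n - 1),
        ((if 2 * p - 1 = j then yGen n (2 * p) else 0) -
          if 2 * p = j then yGen n (2 * p - 1) else 0)) * x + om n * ctr n j x := by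
  simp only [om, Finset.sum_mul, map_sum, ← Finset.sum_add_distrib]
  refine Finset.sum_congr rfl fun p _ => ?_
  rw [mul_assoc, ctr_yGen_mul n _ j hj, ctr_yGen_mul n _ j hj]
  simp only [mul_sub, sub_mul, ite_mul, mul_ite, zero_mul, mul_zero, mul_assoc]
  abel

theorem ctr_even_om_mul (n p : ℕ) (hp : p ∈ Finset.Icc 1 (n - 1)) (x : SpinorModel n) :
    ctr n (2 * p) (om n * x) = -yGen n (2 * p - 1) * x + om n * ctr n (2 * p) x := by
  have hp' := Finset.mem_Icc.mp hp
  rw [ctr_om_mul n _ (by omega), Finset.sum_eq_single_of_mem p hp]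
  · rw [if_neg (by omega), if_pos rfl, zero_sub]
  · intro q hq hqp
    rw [if_neg (by grind), if_neg (by omega), sub_zero]

theorem ctr_odd_om_mul (n p : ℕ) (hp : p ∈ Finset.Icc 1 (n - 1)) (x : SpinorModel n) :
    ctr n (2 * p - 1) (om n * x) = yGen n (2 * p) * x + om n * ctr n (2 * p - 1) x := by
  have hp' := Finset.mem_Icc.mp hp
  rw [ctr_om_mul n _ (by omega), Finset.sum_eq_single_of_mem p hp]
  · rw [if_pos rfl, if_neg (by omega), sub_zero]
  · intro q hq hqp
    have hq' := Finset.mem_Icc.mp hq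
    rw [if_neg (by omega), if_neg (by omega), sub_zero]

/-- A power rule for linear maps satisfying a Leibniz rule with respect to a fixed element. -/
theorem LinearMap.map_pow_of_leibniz {R A : Type*} [CommRing R] [Ring A] [Algebra R A]
    (D : A →ₗ[R] A) (a v : A) (hav : Commute a v) (h1 : D 1 = 0)
    (hD : ∀ x, D (a * x) = v * x + a * D x) (k : ℕ) :
    D (a ^ k) = (k : R) • (v * a ^ (k - 1)) := by
  induction k with
  | zero => simp [h1]
  | succ k ih =>
    rw [pow_succ', hD, ih]
    cases k with
    | zero => simp
    | succ k =>
      have h : a * (v * a ^ k) = v * a ^ (k + 1) := by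
        rw [← mul_assoc, hav.eq, mul_assoc, ← pow_succ']
      simp only [Nat.add_sub_cancel, mul_smul_comm, h]
      push_cast
      module

theorem ctr_ctr_om_pow (n p : ℕ) (hp : p ∈ Finset.Icc 1 (n - 1)) (k : ℕ) :
    ctr n (2 * p - 1) (ctr n (2 * p) (om n ^ k)) =
      -((k : ℂ) • om n ^ (k - 1)) + ((k : ℂ) * ((k - 1 : ℕ) : ℂ)) •
        (yGen n (2 * p - 1) * yGen n (2 * p) * om n ^ (k - 1 - 1)) := by
  have hp' := Finset.mem_Icc.mp hp
  rw [LinearMap.map_pow_of_leibniz _ _ _ (commute_om_yGen n (2 * p - 1)).neg_right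
      (ctr_one n _) (ctr_even_om_mul n p hp), neg_mul, map_smul, map_neg,
    ctr_yGen_mul n _ _ (by omega), if_pos rfl,
    LinearMap.map_pow_of_leibniz _ _ _ (commute_om_yGen n (2 * p))
      (ctr_one n _) (ctr_odd_om_mul n p hp), mul_smul_comm, mul_assoc]
  module

theorem sum_ctr_ctr_om_pow (n : ℕ) (hn : 1 ≤ n) (k : ℕ) :
    ∑ p ∈ Finset.Icc 1 (n - 1), ctr n (2 * p - 1) (ctr n (2 * p) (om n ^ k)) =
      -(((k : ℂ) * ((n : ℂ) - (k : ℂ))) • om n ^ (k - 1)) := by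
  rw [Finset.sum_congr rfl fun p hp => ctr_ctr_om_pow n p hp k, Finset.sum_add_distrib,
    ← Finset.smul_sum, ← Finset.sum_mul, Finset.sum_const, Nat.card_Icc, Nat.add_sub_cancel]
  change _ + _ • (om n * _) = _
  rw [← Nat.cast_smul_eq_nsmul ℂ, Nat.cast_sub hn]
  rcases k with _ | _ | k
  · simp
  · simp only [zero_add, Nat.sub_self, Nat.cast_zero, mul_zero, zero_smul]
    push_cast
    module
  · simp only [Nat.add_sub_cancel, ← pow_succ']
    push_cast
    module

theorem sum_wdg_wdg (n : ℕ) (x : SpinorModel n) :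
    ∑ p ∈ Finset.Icc 1 (n - 1), wdg n (2 * p - 1) (wdg n (2 * p) x) = om n * x := by
  simp [wdg, om, Finset.sum_mul, mul_assoc]

theorem cop_even (n j : ℕ) :
    cop n (2 * j) = Complex.I • (ctr n (j - 1) + wdg n (j - 1)) := by
  rw [cop, if_neg (by omega), if_pos (by omega), Nat.mul_div_cancel_left _ two_pos]

theorem cop_odd (n j : ℕ) (hj : 1 ≤ j) :
    cop n (2 * j + 1) = wdg n (j - 1) - ctr n (j - 1) := by
  rw [cop, if_neg (by omega), if_neg (by omega), show (2 * j + 1) / 2 = j by omega]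

theorem cop_horizontal (n p : ℕ) (hp : 1 ≤ p) :
    cop n (4 * p) = Complex.I • (ctr n (2 * p - 1) + wdg n (2 * p - 1)) ∧
    cop n (4 * p + 1) = wdg n (2 * p - 1) - ctr n (2 * p - 1) ∧
    cop n (4 * p + 2) = Complex.I • (ctr n (2 * p) + wdg n (2 * p)) ∧
    cop n (4 * p + 3) = wdg n (2 * p) - ctr n (2 * p) := by
  refine ⟨?_, ?_, ?_, ?_⟩
  · rw [← cop_even]; congr 1; ring
  · rw [← cop_odd n _ (by omega)]; congr 1; ring
  · exact (congrArg (cop n) (by ring)).trans (cop_even n (2 * p + 1))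
  · exact (congrArg (cop n) (by ring)).trans (cop_odd n (2 * p + 1) (by omega))

theorem neg_cop_comp_add_cop_comp_apply (n p : ℕ) (hp : 1 ≤ p) (x : SpinorModel n) :
    (-(cop n (4 * p) ∘ₗ cop n (4 * p + 2)) + cop n (4 * p + 1) ∘ₗ cop n (4 * p + 3)) x =
      (2 : ℂ) • (wdg n (2 * p - 1) (wdg n (2 * p) x) +
        ctr n (2 * p - 1) (ctr n (2 * p) x)) := by
  obtain ⟨h0, h1, h2, h3⟩ := cop_horizontal n p hp
  rw [h0, h1, h2, h3]
  simp only [LinearMap.add_apply, LinearMap.neg_apply, LinearMap.comp_apply, LinearMap.smul_apply,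
    LinearMap.sub_apply, map_smul, map_add, map_sub]
  simp only [← smul_add, smul_smul, Complex.I_mul_I]
  module

theorem cop_comp_add_cop_comp_apply (n p : ℕ) (hp : 1 ≤ p) (x : SpinorModel n) :
    (cop n (4 * p) ∘ₗ cop n (4 * p + 3) + cop n (4 * p + 1) ∘ₗ cop n (4 * p + 2)) x =
      (2 * Complex.I) • (wdg n (2 * p - 1) (wdg n (2 * p) x) -
        ctr n (2 * p - 1) (ctr n (2 * p) x)) := by
  obtain ⟨h0, h1, h2, h3⟩ := cop_horizontal n p hp
  rw [h0, h1, h2, h3]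
  simp only [LinearMap.add_apply, LinearMap.comp_apply, LinearMap.smul_apply,
    LinearMap.sub_apply, map_smul, map_add, map_sub]
  module

/-- In the exterior-form model of the spin representation on a
`(4n-1)`-dimensional homogeneous 3-Sasakian space, the Clifford products of the invariant
fundamental two-forms `Φ₂|_H` and `Φ₃|_H` with `ω^k` are
`(Φ₂|_H)·ω^k = 2(ω^{k+1} - k(n-k)·ω^{k-1})` and
`(Φ₃|_H)·ω^k = -2i(ω^{k+1} + k(n-k)·ω^{k-1})`, where
`Φ₂|_H = ∑_{p=1}^{n-1}(-c_{4p}∘c_{4p+2} + c_{4p+1}∘c_{4p+3})` and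
`Φ₃|_H = -∑_{p=1}^{n-1}(c_{4p}∘c_{4p+3} + c_{4p+1}∘c_{4p+2})`
(with the conventions `ω⁰ = 1`, `ω^{-1} = 0`; note that the `ω^{k-1}`-terms carry the
coefficient `k(n-k)`, which vanishes for `k = 0`). -/
theorem clifford_product_Phi2_Phi3_omega_pow (n : ℕ) (hn : 1 ≤ n) (k : ℕ) :
    (∑ p ∈ Finset.Icc 1 (n - 1),
        (-(cop n (4 * p) ∘ₗ cop n (4 * p + 2)) + cop n (4 * p + 1) ∘ₗ cop n (4 * p + 3)))
        (om n ^ k) =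
      (2 : ℂ) • (om n ^ (k + 1) - ((k : ℂ) * ((n : ℂ) - (k : ℂ))) • om n ^ (k - 1)) ∧
    (-∑ p ∈ Finset.Icc 1 (n - 1),
        (cop n (4 * p) ∘ₗ cop n (4 * p + 3) + cop n (4 * p + 1) ∘ₗ cop n (4 * p + 2)))
        (om n ^ k) =
      (-2 * Complex.I) • (om n ^ (k + 1) + ((k : ℂ) * ((n : ℂ) - (k : ℂ))) • om n ^ (k - 1)) := by
  have hmem : ∀ p ∈ Finset.Icc 1 (n - 1), 1 ≤ p := fun p hp => (Finset.mem_Icc.mp hp).1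
  constructor
  · rw [LinearMap.sum_apply, Finset.sum_congr rfl fun p hp =>
        neg_cop_comp_add_cop_comp_apply n p (hmem p hp) _, ← Finset.smul_sum,
      Finset.sum_add_distrib, sum_wdg_wdg, sum_ctr_ctr_om_pow n hn, ← pow_succ', ← sub_eq_add_neg]
  · rw [LinearMap.neg_apply, LinearMap.sum_apply, Finset.sum_congr rfl fun p hp =>
        cop_comp_add_cop_comp_apply n p (hmem p hp) _, ← Finset.smul_sum,
      Finset.sum_sub_distrib, sum_wdg_wdg, sum_ctr_ctr_om_pow n hn, ← pow_succ', sub_neg_eq_add,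
      neg_mul, neg_smul]
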